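/- arXiv:2501.01571 — 5 statements merged into one kernel-verified Lean document; each statement's English description precedes it below -/
import Mathlib

section
/- The packing density of the set {0, 1, 4, 6} is at most 1/7, i.e. d_p({0,1,4,6}) ≤ 1/7. -/
open Pointwise Filter

/-- The difference set of `S`: `{s - t : s, t ∈ S, s ≥ t}`. -/
def diffSet (S : Set ℤ) : Set ℤ := {d | ∃ s ∈ S, ∃ t ∈ S, t ≤ s ∧ d = s - t}

/-- `A` is `S`-packing if translates `S + a₁` and `S + a₂` are disjoint for distinct `a₁, a₂ ∈ A`. -/
def SPacking (S A : Set ℤ) : Prop :=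
  ∀ a₁ ∈ A, ∀ a₂ ∈ A, a₁ ≠ a₂ →
    Disjoint ((fun s => s + a₁) '' S) ((fun s => s + a₂) '' S)

/-- Upper density of `A ⊆ ℤ`. -/
noncomputable def upperDensity (A : Set ℤ) : ℝ :=
  limsup (fun n : ℕ => ((A ∩ Set.Icc (-(n : ℤ)) (n : ℤ)).ncard : ℝ) / (2 * n + 1)) atTop

/-- Lower density of `A ⊆ ℤ`. -/
noncomputable def lowerDensity (A : Set ℤ) : ℝ :=
  liminf (fun n : ℕ => ((A ∩ Set.Icc (-(n : ℤ)) (n : ℤ)).ncard : ℝ) / (2 * n + 1)) atTop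

/-- Packing density of `S`: supremum of upper densities of `S`-packing sets. -/
noncomputable def packingDensity (S : Set ℤ) : ℝ :=
  sSup {d : ℝ | ∃ A : Set ℤ, SPacking S A ∧ d = upperDensity A}

/-- `t`, `A` are the sequences produced by the greedy packing algorithm for `S`:
`A₋₁ = ∅`, and for `i ≥ 0`, `tᵢ = min {x : x ≥ 0, x ∉ Aᵢ₋₁ + diff S}` and `Aᵢ = Aᵢ₋₁ ∪ {tᵢ}`. -/
def GreedySeq (S : Set ℤ) (t : ℕ → ℤ) (A : ℕ → Set ℤ) : Prop :=
  IsLeast {x : ℤ | 0 ≤ x ∧ x ∉ (∅ : Set ℤ) + diffSet S} (t 0) ∧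
  (∀ i : ℕ, IsLeast {x : ℤ | 0 ≤ x ∧ x ∉ A i + diffSet S} (t (i + 1))) ∧
  A 0 = (∅ : Set ℤ) ∪ {t 0} ∧
  (∀ i : ℕ, A (i + 1) = A i ∪ {t (i + 1)})

/-- `A` is `a`-forward-periodic with period `p`. -/
def FwdPeriodic (A : Set ℤ) (a p : ℤ) : Prop :=
  ∀ i : ℤ, 0 ≤ i → ((a + i ∈ A) ↔ (a + i + p ∈ A))

/-- Interval density of `A` restricted to `[a, b-1]`. -/
noncomputable def intervalDensity (A : Set ℤ) (a b : ℤ) : ℝ :=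
  ((A ∩ Set.Icc a (b - 1)).ncard : ℝ) / ((b : ℝ) - a)

/-- Distinct elements of a `{0, 1, 4, 6}`-packing set are at least `7` apart. -/
theorem SPacking.add_seven_le {A : Set ℤ} (hA : SPacking {0, 1, 4, 6} A) {a b : ℤ}
    (ha : a ∈ A) (hb : b ∈ A) (hab : a < b) : a + 7 ≤ b := by
  by_contra! h
  have hdisj := Set.disjoint_left.1 (hA a ha b hb hab.ne)
  have key : ∀ s ∈ ({0, 1, 4, 6} : Set ℤ), ∀ t ∈ ({0, 1, 4, 6} : Set ℤ), s + a ≠ t + b :=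
    fun s hs t ht hst => hdisj ⟨s, hs, rfl⟩ ⟨t, ht, hst.symm⟩
  have h10 := key 1 (by simp) 0 (by simp)
  have h64 := key 6 (by simp) 4 (by simp)
  have h41 := key 4 (by simp) 1 (by simp)
  have h40 := key 4 (by simp) 0 (by simp)
  have h61 := key 6 (by simp) 1 (by simp)
  have h60 := key 6 (by simp) 0 (by simp)
  omega

theorem SPacking.seven_mul_ncard_le {A : Set ℤ} (hA : SPacking {0, 1, 4, 6} A) (n : ℕ) :
    7 * (A ∩ Set.Icc (-(n : ℤ)) n).ncard ≤ 2 * n + 7 := by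
  have hle : (A ∩ Set.Icc (-(n : ℤ)) n).ncard ≤ (Set.Iio (2 * n / 7 + 1)).ncard := by
    refine Set.ncard_le_ncard_of_injOn (fun x => ((x + n) / 7).toNat) ?_ ?_ (Set.finite_Iio _)
    · rintro x ⟨-, hx⟩
      simp only [Set.mem_Icc, Set.mem_Iio] at hx ⊢
      omega
    · rintro x ⟨hxA, hx⟩ y ⟨hyA, hy⟩ hxy
      simp only [Set.mem_Icc] at hx hy hxy
      rcases lt_trichotomy x y with h | h | h
      · have := hA.add_seven_le hxA hyA h
        omega
      · exact h
      · have := hA.add_seven_le hyA hxA h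
        omega
  have hcard : (Set.Iio (2 * n / 7 + 1)).ncard = 2 * n / 7 + 1 := by
    rw [← Finset.coe_Iio, Set.ncard_coe_finset, Nat.card_Iio]
  omega

theorem SPacking.upperDensity_le {A : Set ℤ} (hA : SPacking {0, 1, 4, 6} A) :
    upperDensity A ≤ 1 / 7 := by
  have hlim : Tendsto (fun n : ℕ => (1 / 7 : ℝ) + 6 / 7 / (2 * n + 1)) atTop (nhds (1 / 7)) := by
    have hden : Tendsto (fun n : ℕ => (2 : ℝ) * n + 1) atTop atTop :=
      tendsto_atTop_add_const_right _ _
        (tendsto_natCast_atTop_atTop.const_mul_atTop (by norm_num))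
    simpa only [add_zero] using (hden.const_div_atTop (6 / 7 : ℝ)).const_add (1 / 7)
  rw [upperDensity, ← hlim.limsup_eq]
  refine limsup_le_limsup (Eventually.of_forall fun n => ?_) ?_ hlim.isBoundedUnder_le
  · have h : (7 : ℝ) * (A ∩ Set.Icc (-(n : ℤ)) n).ncard ≤ 2 * n + 7 := by
      exact_mod_cast hA.seven_mul_ncard_le n
    have hpos : (0 : ℝ) < 2 * n + 1 := by positivity
    have hsum : (1 / 7 : ℝ) + 6 / 7 / (2 * n + 1) = (2 * n + 7) / 7 / (2 * n + 1) := by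
      field_simp
      ring
    simp only [hsum]
    gcongr
    linarith
  · exact IsBoundedUnder.isCoboundedUnder_le
      ⟨0, eventually_map.2 (Eventually.of_forall fun n => by positivity)⟩

theorem stmt2 : packingDensity {0, 1, 4, 6} ≤ 1 / 7 := by
  refine Real.sSup_le ?_ (by norm_num)
  rintro d ⟨A, hA, rfl⟩
  exact hA.upperDensity_le
end

section
/- Let S ⊆ ℤ be a finite nonempty set, and let t_i and A_i be produced by the greedy packing algorithm for S. Then for all i ≥ 0, t_i ≤ i · |diff(S)|. -/
open Pointwise Filter

theorem diffSet_finite {S : Set ℤ} (hS : S.Finite) : (diffSet S).Finite := by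
  refine (hS.sub hS).subset ?_
  rintro d ⟨s, hs, t, ht, -, rfl⟩
  exact Set.sub_mem_sub hs ht

theorem GreedySeq.finite_and_ncard_le {S : Set ℤ} {t : ℕ → ℤ} {A : ℕ → Set ℤ}
    (hg : GreedySeq S t A) (i : ℕ) : (A i).Finite ∧ (A i).ncard ≤ i + 1 := by
  obtain ⟨-, -, hA0, hA⟩ := hg
  induction i with
  | zero => simp [hA0]
  | succ i ih =>
    rw [hA]
    refine ⟨ih.1.union (Set.finite_singleton _), (Set.ncard_union_le _ _).trans ?_⟩
    simpa using ih.2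

theorem IsLeast.le_ncard_of_nonneg_notMem {B : Set ℤ} (hB : B.Finite) {x : ℤ}
    (hx : IsLeast {y : ℤ | 0 ≤ y ∧ y ∉ B} x) : x ≤ B.ncard := by
  have hsub : Set.Ico 0 x ⊆ B := by
    intro y hy
    by_contra hyB
    exact absurd (hx.2 ⟨hy.1, hyB⟩) (not_le.mpr hy.2)
  have hcard := Set.ncard_le_ncard hsub hB
  rw [← Finset.coe_Ico, Set.ncard_coe_finset, Int.card_Ico] at hcard
  omega

theorem stmt4 (S : Set ℤ) (hfin : S.Finite) (hne : S.Nonempty)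
    (t : ℕ → ℤ) (A : ℕ → Set ℤ) (hg : GreedySeq S t A) :
    ∀ i : ℕ, t i ≤ (i : ℤ) * (diffSet S).ncard := by
  intro i
  cases i with
  | zero => simpa using IsLeast.le_ncard_of_nonneg_notMem (by simp) hg.1
  | succ i =>
    obtain ⟨hA, hcard⟩ := hg.finite_and_ncard_le i
    refine (IsLeast.le_ncard_of_nonneg_notMem (hA.add (diffSet_finite hfin)) (hg.2.1 i)).trans ?_
    have hadd : (A i + diffSet S).ncard ≤ (A i).ncard * (diffSet S).ncard :=
      Set.natCard_add_le
    exact_mod_cast hadd.trans (Nat.mul_le_mul_right _ hcard)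
end

section
/- Let S ⊆ ℤ be a finite nonempty set, let {t_i} and {A_i} be produced by the greedy packing algorithm for S, and let A_∞ = ⋃_{i ≥ 0} A_i. Then there exist integers a, b with 0 ≤ a < b such that A_∞ is a-forward-periodic with period b - a. -/
open Pointwise Filter

theorem zero_mem_diffSet {S : Set ℤ} (hne : S.Nonempty) : (0 : ℤ) ∈ diffSet S := by
  obtain ⟨s, hs⟩ := hne
  exact ⟨s, hs, s, hs, le_rfl, (sub_self s).symm⟩

theorem nonneg_of_mem_diffSet {S : Set ℤ} {d : ℤ} (hd : d ∈ diffSet S) : 0 ≤ d := by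
  obtain ⟨s, _, t, _, hts, rfl⟩ := hd
  omega

theorem exists_nat_bound_diffSet {S : Set ℤ} (hfin : S.Finite) :
    ∃ M : ℕ, ∀ d ∈ diffSet S, d ≤ M := by
  obtain ⟨u, hu⟩ := hfin.bddAbove
  obtain ⟨l, hl⟩ := hfin.bddBelow
  refine ⟨(u - l).toNat, ?_⟩
  rintro d ⟨s, hs, t, ht, _, rfl⟩
  have h₁ := hu hs
  have h₂ := hl ht
  omega

namespace GreedySeq

variable {S : Set ℤ} {t : ℕ → ℤ} {A : ℕ → Set ℤ}

theorem mem_iff (hg : GreedySeq S t A) (n : ℕ) (x : ℤ) : x ∈ A n ↔ ∃ i ≤ n, x = t i := by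
  induction n with
  | zero => simp [hg.2.2.1]
  | succ n ih =>
    rw [hg.2.2.2 n, Set.mem_union, ih, Set.mem_singleton_iff]
    constructor
    · rintro (⟨i, hi, rfl⟩ | rfl)
      · exact ⟨i, by omega, rfl⟩
      · exact ⟨n + 1, le_rfl, rfl⟩
    · rintro ⟨i, hi, rfl⟩
      rcases Nat.le_succ_iff.mp hi with h | rfl
      · exact Or.inl ⟨i, h, rfl⟩
      · exact Or.inr rfl

theorem mem_iUnion_iff (hg : GreedySeq S t A) (x : ℤ) : x ∈ ⋃ i, A i ↔ ∃ i, x = t i := by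
  simp only [Set.mem_iUnion, hg.mem_iff]
  exact ⟨fun ⟨_, i, _, h⟩ => ⟨i, h⟩, fun ⟨i, h⟩ => ⟨i, i, le_rfl, h⟩⟩

theorem strictMono (hne : S.Nonempty) (hg : GreedySeq S t A) : StrictMono t := by
  have hnot : ∀ i j, i ≤ j → t (j + 1) ≠ t i := fun i j hij h =>
    (hg.2.1 j).1.2 (Set.mem_add.mpr
      ⟨t i, (hg.mem_iff j _).2 ⟨i, hij, rfl⟩, 0, zero_mem_diffSet hne, by omega⟩)
  refine strictMono_nat_of_lt_succ fun n => lt_of_le_of_ne ?_ (hnot n n le_rfl).symm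
  cases n with
  | zero => exact hg.1.2 ⟨(hg.2.1 0).1.1, by simp⟩
  | succ n =>
    refine (hg.2.1 n).2 ⟨(hg.2.1 (n + 1)).1.1, fun h => (hg.2.1 (n + 1)).1.2 ?_⟩
    refine Set.add_subset_add_right ?_ h
    rw [hg.2.2.2 n]
    exact Set.subset_union_left

/-- Membership in the greedy packing is determined by membership at the preceding positions whose
distance lies in `diffSet S`. -/
theorem mem_iUnion_iff_forall_sub_notMem (hne : S.Nonempty) (hg : GreedySeq S t A)
    {x : ℤ} (hx : 0 ≤ x) :
    x ∈ ⋃ i, A i ↔ ∀ d ∈ diffSet S, 0 < d → x - d ∉ ⋃ i, A i := by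
  have hmono := hg.strictMono hne
  simp only [hg.mem_iUnion_iff]
  constructor
  · rintro ⟨k, rfl⟩ d hd hpos ⟨j, hj⟩
    have hjk : j < k := hmono.lt_iff_lt.mp (by omega)
    obtain ⟨k, rfl⟩ : ∃ k', k = k' + 1 := ⟨k - 1, by omega⟩
    exact (hg.2.1 k).1.2 (Set.mem_add.mpr
      ⟨t j, (hg.mem_iff k _).2 ⟨j, by omega, rfl⟩, d, hd, by omega⟩)
  · intro h
    by_contra hnot
    have hgrow : ∀ n : ℕ, (n : ℤ) ≤ t n := by
      intro n
      induction n with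
      | zero => exact_mod_cast hg.1.1.1
      | succ n ih =>
        have := hmono (Nat.lt_add_one n)
        push_cast
        omega
    have hlt : x < t (x.toNat + 1) := by
      have := hgrow (x.toNat + 1)
      push_cast at this
      omega
    have hmem : x ∈ A x.toNat + diffSet S := by
      by_contra hcon
      exact absurd ((hg.2.1 x.toNat).2 ⟨hx, hcon⟩) (not_le.mpr hlt)
    obtain ⟨a, ha, d, hd, rfl⟩ := Set.mem_add.mp hmem
    obtain ⟨i, -, rfl⟩ := (hg.mem_iff _ _).1 ha
    rcases (nonneg_of_mem_diffSet hd).eq_or_lt with rfl | hpos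
    · exact hnot ⟨i, by omega⟩
    · exact h d hd hpos ⟨i, by omega⟩

end GreedySeq

/-- A set of integers whose membership at nonnegative positions is determined by a bounded window
of preceding positions is eventually periodic. -/
theorem exists_fwdPeriodic_of_forall_sub_notMem {B D : Set ℤ} {M : ℕ} (hD : ∀ d ∈ D, d ≤ M)
    (hB : ∀ x, 0 ≤ x → (x ∈ B ↔ ∀ d ∈ D, 0 < d → x - d ∉ B)) :
    ∃ a b : ℤ, 0 ≤ a ∧ a < b ∧ FwdPeriodic B a (b - a) := by
  obtain ⟨m, n, hmn, hwin⟩ : ∃ m n : ℕ, m < n ∧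
      ∀ j : Fin M, ((m : ℤ) + (j : ℕ) ∈ B ↔ (n : ℤ) + (j : ℕ) ∈ B) := by
    obtain ⟨m, n, hne, h⟩ := Finite.exists_ne_map_eq_of_infinite
      (fun n : ℕ => {j : Fin M | (n : ℤ) + (j : ℕ) ∈ B})
    have h' := fun j => Set.ext_iff.mp h j
    rcases hne.lt_or_gt with hlt | hlt
    · exact ⟨m, n, hlt, h'⟩
    · exact ⟨n, m, hlt, fun j => (h' j).symm⟩
  have key : ∀ i : ℕ, ((m : ℤ) + i ∈ B ↔ (n : ℤ) + i ∈ B) := by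
    intro i
    induction i using Nat.strong_induction_on with
    | _ i ih =>
      rcases lt_or_ge i M with hi | hi
      · exact hwin ⟨i, hi⟩
      · rw [hB _ (by omega), hB _ (by omega)]
        refine forall₃_congr fun d hd hpos => not_congr ?_
        have hdM := hD d hd
        have := ih (i - d.toNat) (by omega)
        convert this using 2 <;> omega
  refine ⟨m, n, by omega, by omega, fun i hi => ?_⟩
  have := key i.toNat
  convert this using 2 <;> omega

theorem stmt5 (S : Set ℤ) (hfin : S.Finite) (hne : S.Nonempty)
    (t : ℕ → ℤ) (A : ℕ → Set ℤ) (hg : GreedySeq S t A)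
    (Ainf : Set ℤ) (hAinf : Ainf = ⋃ i : ℕ, A i) :
    ∃ a b : ℤ, 0 ≤ a ∧ a < b ∧ FwdPeriodic Ainf a (b - a) := by
  subst hAinf
  obtain ⟨M, hM⟩ := exists_nat_bound_diffSet hfin
  exact exists_fwdPeriodic_of_forall_sub_notMem hM
    fun _ hx => hg.mem_iUnion_iff_forall_sub_notMem hne hx
end

section
/- Let A ⊆ ℤ, and let a, b ∈ ℤ with a < b be such that A is a-forward-periodic with period b - a. Then the limit lim_{n→∞} d(A, 0, n) exists and equals the interval density d(A, a, b). -/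
open Pointwise Filter

/-- A window of length `p` starting at or after `a` meets an `a`-forward-periodic set in as many
elements as the window starting at `a`. -/
theorem FwdPeriodic.ncard_inter_Icc {A : Set ℤ} {a : ℤ} {p : ℕ} (h : FwdPeriodic A a p) {x : ℤ}
    (hx : a ≤ x) : (A ∩ Set.Icc x (x + p - 1)).ncard = (A ∩ Set.Icc a (a + p - 1)).ncard := by
  classical
  have key : ∀ m : ℕ, (A ∩ Set.Icc (a + m) (a + m + p - 1)).ncard =
      p.count (fun i : ℕ => a + i ∈ A) := by
    intro m
    have hper : Function.Periodic (fun i : ℕ => a + (i : ℤ) ∈ A) p := by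
      intro i
      have := h i (by positivity)
      simp only [Nat.cast_add, ← add_assoc]
      exact propext this.symm
    rw [← Nat.filter_Ico_card_eq_of_periodic m p _ hper, ← Set.ncard_coe_finset]
    have himg : A ∩ Set.Icc (a + m) (a + m + p - 1) = (fun i : ℕ => a + (i : ℤ)) ''
        ((Finset.Ico m (m + p)).filter (fun i : ℕ => a + (i : ℤ) ∈ A) : Finset ℕ) := by
      ext y
      simp only [Set.mem_inter_iff, Set.mem_Icc, Set.mem_image, Finset.mem_coe,
        Finset.mem_filter, Finset.mem_Ico]
      constructor
      · rintro ⟨hy, h1, h2⟩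
        have e : a + ((y - a).toNat : ℤ) = y := by omega
        exact ⟨(y - a).toNat, ⟨by omega, by rwa [e]⟩, e⟩
      · rintro ⟨i, ⟨hi, hA⟩, rfl⟩
        exact ⟨hA, by omega, by omega⟩
    rw [himg, Set.ncard_image_of_injective]
    intro i j hij
    simpa using hij
  obtain ⟨m, rfl⟩ := Int.le.dest hx
  simpa [key m] using (key 0).symm

/-- A real sequence that is periodic from some index on is bounded. -/
theorem exists_abs_le_of_eventually_periodic {g : ℕ → ℝ} {p N : ℕ} (hp : 0 < p)
    (h : ∀ n, N ≤ n → g (n + p) = g n) : ∃ C, ∀ n, |g n| ≤ C := by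
  refine ⟨∑ i ∈ Finset.range (N + p), |g i|, fun n => ?_⟩
  induction n using Nat.strong_induction_on with
  | _ n ih =>
    rcases lt_or_ge n (N + p) with hn | hn
    · exact Finset.single_le_sum (f := fun i => |g i|) (fun i _ => abs_nonneg _)
        (Finset.mem_range.2 hn)
    · have := h (n - p) (by omega)
      rw [Nat.sub_add_cancel (by omega)] at this
      rw [this]
      exact ih _ (by omega)

/-- If `c (n + p) = c n + k` from some index on, then `c n / n` tends to `k / p`. -/
theorem tendsto_div_of_eventually_add_period {c : ℕ → ℝ} {k : ℝ} {p N : ℕ} (hp : 0 < p)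
    (h : ∀ n, N ≤ n → c (n + p) = c n + k) :
    Tendsto (fun n : ℕ => c n / n) atTop (nhds (k / p)) := by
  have hp' : (p : ℝ) ≠ 0 := by positivity
  obtain ⟨C, hC⟩ := exists_abs_le_of_eventually_periodic (g := fun n => c n - n * (k / p)) hp
    (N := N) (fun n hn => by
      simp only [h n hn, Nat.cast_add]
      field_simp
      ring)
  have hlim : Tendsto (fun n : ℕ => (c n - n * (k / p)) / n) atTop (nhds 0) := by
    refine squeeze_zero_norm (fun n => ?_) (tendsto_const_div_atTop_nhds_zero_nat C)
    rw [Real.norm_eq_abs, abs_div, Nat.abs_cast]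
    gcongr
    exact hC n
  have := hlim.add_const (k / p)
  rw [zero_add] at this
  refine this.congr' ?_
  filter_upwards [eventually_gt_atTop 0] with n hn
  have : (n : ℝ) ≠ 0 := by positivity
  field_simp
  ring

theorem stmt6 (A : Set ℤ) (a b : ℤ) (hab : a < b) (hp : FwdPeriodic A a (b - a)) :
    Tendsto (fun n : ℕ => intervalDensity A 0 (n : ℤ)) atTop
      (nhds (intervalDensity A a b)) := by
  obtain ⟨p, hpb⟩ := Int.le.dest hab.le
  obtain rfl : b = a + p := hpb.symm
  rw [add_sub_cancel_left] at hp
  have hp0 : 0 < p := by omega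
  have step : ∀ n : ℕ, a.toNat ≤ n →
      ((A ∩ Set.Icc 0 (((n + p : ℕ) : ℤ) - 1)).ncard : ℝ) =
        (A ∩ Set.Icc 0 ((n : ℤ) - 1)).ncard + (A ∩ Set.Icc a (a + p - 1)).ncard := by
    intro n hn
    have hsplit : A ∩ Set.Icc 0 (((n + p : ℕ) : ℤ) - 1) =
        (A ∩ Set.Icc 0 ((n : ℤ) - 1)) ∪ (A ∩ Set.Icc (n : ℤ) (n + p - 1)) := by
      rw [← Set.inter_union_distrib_left]
      congr 1
      ext y
      simp only [Set.mem_Icc, Set.mem_union]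
      omega
    have hdisj : Disjoint (A ∩ Set.Icc 0 ((n : ℤ) - 1)) (A ∩ Set.Icc (n : ℤ) (n + p - 1)) := by
      rw [Set.disjoint_left]
      rintro y ⟨-, hy⟩ ⟨-, hy'⟩
      simp only [Set.mem_Icc] at hy hy'
      omega
    rw [hsplit, Set.ncard_union_eq hdisj ((Set.finite_Icc _ _).inter_of_right _)
      ((Set.finite_Icc _ _).inter_of_right _), hp.ncard_inter_Icc (by omega), Nat.cast_add]
  simpa [intervalDensity] using tendsto_div_of_eventually_add_period hp0 step
end

section
/- Let S ⊆ ℤ be a finite nonempty set, let A_∞ be the set produced by the greedy packing algorithm for S, and let a < b be integers such that A_∞ is a-forward-periodic with period b - a. Define A ⊆ ℤ by: x ∈ A if and only if a + r(x) ∈ A_∞, where r(x) is the unique integer with 0 ≤ r(x) < b - a and x - a ≡ r(x) (mod b - a). Then A is S-packing. -/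
open Pointwise Filter

theorem GreedySeq.monotone {S : Set ℤ} {t : ℕ → ℤ} {As : ℕ → Set ℤ} (hg : GreedySeq S t As) :
    Monotone As :=
  monotone_nat_of_le_succ fun i => by
    rw [hg.2.2.2 i]
    exact Set.subset_union_left

theorem GreedySeq.monotone_choice {S : Set ℤ} {t : ℕ → ℤ} {As : ℕ → Set ℤ}
    (hg : GreedySeq S t As) : Monotone t := by
  refine monotone_nat_of_le_succ fun i => ?_
  have hmem := (hg.2.1 i).1
  cases i with
  | zero => exact hg.1.2 ⟨hmem.1, by simp⟩
  | succ i =>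
    exact (hg.2.1 i).2
      ⟨hmem.1, fun h => hmem.2 (Set.add_subset_add_right (hg.monotone i.le_succ) h)⟩

theorem GreedySeq.choice_mem {S : Set ℤ} {t : ℕ → ℤ} {As : ℕ → Set ℤ}
    (hg : GreedySeq S t As) (i : ℕ) : t i ∈ As i := by
  cases i with
  | zero => simp [hg.2.2.1]
  | succ i => simp [hg.2.2.2 i]

theorem GreedySeq.exists_of_mem {S : Set ℤ} {t : ℕ → ℤ} {As : ℕ → Set ℤ}
    (hg : GreedySeq S t As) {x : ℤ} (i : ℕ) (hx : x ∈ As i) : ∃ j, x = t j := by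
  induction i with
  | zero =>
    rw [hg.2.2.1] at hx
    exact ⟨0, by simpa using hx⟩
  | succ i ih =>
    rw [hg.2.2.2 i] at hx
    exact hx.elim ih fun h => ⟨i + 1, h⟩

/-- Differences of elements produced by the greedy algorithm avoid the difference set. -/
theorem GreedySeq.sub_notMem_diffSet {S : Set ℤ} {t : ℕ → ℤ} {As : ℕ → Set ℤ}
    (hg : GreedySeq S t As) {x y : ℤ} (hx : x ∈ ⋃ i, As i) (hy : y ∈ ⋃ i, As i) (hxy : x < y) :
    y - x ∉ diffSet S := by
  obtain ⟨i, hi⟩ := Set.mem_iUnion.1 hx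
  obtain ⟨j, hj⟩ := Set.mem_iUnion.1 hy
  obtain ⟨i, rfl⟩ := hg.exists_of_mem i hi
  obtain ⟨j, rfl⟩ := hg.exists_of_mem j hj
  have hij : i < j := hg.monotone_choice.reflect_lt hxy
  intro hd
  cases j with
  | zero => omega
  | succ j =>
    exact (hg.2.1 j).1.2
      ⟨t i, hg.monotone (Nat.lt_succ_iff.1 hij) (hg.choice_mem i), _, hd, by simp⟩

theorem FwdPeriodic.mem_add_mul_iff {A : Set ℤ} {a p : ℤ} (h : FwdPeriodic A a p) (hp : 0 ≤ p)
    {i : ℤ} (hi : 0 ≤ i) (n : ℕ) : a + i ∈ A ↔ a + i + n * p ∈ A := by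
  induction n with
  | zero => simp
  | succ n ih =>
    rw [ih, add_assoc, h (i + n * p) (by positivity)]
    push_cast
    ring_nf

theorem sPacking_of_sub_notMem_diffSet {S A : Set ℤ}
    (h : ∀ x ∈ A, ∀ y ∈ A, x < y → y - x ∉ diffSet S) : SPacking S A := by
  intro x hx y hy hne
  rw [Set.disjoint_left]
  rintro _ ⟨s, hs, rfl⟩ ⟨u, hu, hsu⟩
  dsimp only at hsu
  rcases lt_or_gt_of_ne hne with hlt | hlt
  · exact h x hx y hy hlt ⟨s, hs, u, hu, by omega, by omega⟩
  · exact h y hy x hx hlt ⟨u, hu, s, hs, by omega, by omega⟩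

theorem stmt7 (S : Set ℤ) (hfin : S.Finite) (hne : S.Nonempty)
    (t : ℕ → ℤ) (As : ℕ → Set ℤ) (hg : GreedySeq S t As)
    (Ainf : Set ℤ) (hAinf : Ainf = ⋃ i : ℕ, As i)
    (a b : ℤ) (hab : a < b) (hp : FwdPeriodic Ainf a (b - a))
    (A : Set ℤ) (hA : ∀ x : ℤ, x ∈ A ↔ a + (x - a) % (b - a) ∈ Ainf) :
    SPacking S A := by
  subst hAinf
  have hpos : 0 < b - a := sub_pos.2 hab
  refine sPacking_of_sub_notMem_diffSet fun x hx y hy hxy => ?_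
  rw [hA] at hx hy
  obtain ⟨n, hn⟩ := Int.eq_ofNat_of_zero_le
    (sub_nonneg.2 (Int.ediv_le_ediv hpos (sub_le_sub_right hxy.le a)))
  have hy' := (hp.mem_add_mul_iff hpos.le (Int.emod_nonneg _ hpos.ne') n).1 hy
  have hdiff : a + (y - a) % (b - a) + n * (b - a) - (a + (x - a) % (b - a)) = y - x := by
    rw [← hn]
    linear_combination Int.emod_add_mul_ediv (y - a) (b - a) -
      Int.emod_add_mul_ediv (x - a) (b - a)
  rw [← hdiff]
  exact hg.sub_notMem_diffSet hx hy' (by omega)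
end
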